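/- Let φ: ℕ → F₂ be a surjective map and (a_n) a sequence of positive real numbers with ∑_{n ∈ φ⁻¹(s)} a_n = 1 for every s ∈ F₂. Then it is NOT the case that for every x ∈ C*_r(F₂) and every permutation σ of ℕ the series ∑_{n=1}^∞ a_{σ(n)} δ_{φ(σ(n))}(x) λ_{φ(σ(n))} converges in norm to x. In other words, no frame for C*_r(F₂) of the form (λ_{φ(n)}, a_n δ_{φ(n)}) with these properties is unconditional. -/

import Mathlib

noncomputable section

open Filter
open scoped ENNReal

/-- The free group on two generators. -/
abbrev G2 : Type := FreeGroup (Fin 2)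

/-- The word length of an element of `F₂`, i.e. the length of its reduced word. -/
def wlen (s : G2) : ℕ := (FreeGroup.toWord s).length

/-- The Hilbert space `ℓ²(F₂)`. -/
abbrev H2 : Type := lp (fun _ : G2 => ℂ) 2

lemma memℓp_translate (s : G2) (ξ : H2) : Memℓp (fun t => ξ (s⁻¹ * t)) 2 := by
  have h : Summable fun t : G2 => ‖ξ t‖ ^ (2 : ℝ≥0∞).toReal :=
    (memℓp_gen_iff (by norm_num)).1 (lp.memℓp ξ)
  refine memℓp_gen ?_
  exact ((Equiv.mulLeft (s⁻¹ : G2)).summable_iff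
    (f := fun t : G2 => ‖ξ t‖ ^ (2 : ℝ≥0∞).toReal)).2 h

/-- The left regular representation of `F₂` on `ℓ²(F₂)`: `(λ_s ξ)(t) = ξ(s⁻¹ t)`,
as a bounded operator. -/
def lam (s : G2) : H2 →L[ℂ] H2 :=
  LinearMap.mkContinuous
    { toFun := fun ξ => ⟨fun t => ξ (s⁻¹ * t), memℓp_translate s ξ⟩
      map_add' := by
        intro ξ η
        apply Subtype.ext
        funext t
        rfl
      map_smul' := by
        intro c ξ
        apply Subtype.ext
        funext t
        rfl }
    1
    (by
      intro ξ
      have h2 : (0:ℝ) < (2 : ℝ≥0∞).toReal := by norm_num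
      rw [one_mul]
      apply le_of_eq
      rw [lp.norm_eq_tsum_rpow h2, lp.norm_eq_tsum_rpow h2]
      congr 1
      exact (Equiv.mulLeft (s⁻¹ : G2)).tsum_eq
        (f := fun t : G2 => ‖ξ t‖ ^ (2 : ℝ≥0∞).toReal))

/-- The reduced free group C*-algebra `C*_r(F₂)`, realized as the operator-norm closure of
`span{λ_s : s ∈ F₂}` inside `B(ℓ²(F₂))`. -/
def CrF2 : Submodule ℂ (H2 →L[ℂ] H2) :=
  (Submodule.span ℂ (Set.range lam)).topologicalClosure

lemma lam_mem_CrF2 (s : G2) : lam s ∈ CrF2 :=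
  Submodule.le_topologicalClosure _ (Submodule.subset_span ⟨s, rfl⟩)

/-- `λ_s` as an element of `C*_r(F₂)`. -/
def lamCr (s : G2) : CrF2 := ⟨lam s, lam_mem_CrF2 s⟩

/-- The vector `δ_s ∈ ℓ²(F₂)`. -/
def deltaVec (s : G2) : H2 := lp.single 2 s 1

/-- The functional `δ_s : x ↦ ⟨x δ_e, δ_s⟩` on `B(ℓ²(F₂))`. -/
def deltaFn (s : G2) : (H2 →L[ℂ] H2) →L[ℂ] ℂ :=
  (innerSL ℂ (deltaVec s)).comp (ContinuousLinearMap.apply ℂ H2 (deltaVec 1))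

/-- The functional `δ_s` restricted to `C*_r(F₂)`. -/
def deltaCr (s : G2) : CrF2 →L[ℂ] ℂ := (deltaFn s).comp CrF2.subtypeL

/-- The amplification sending an `n × n` matrix of bounded operators on `ℓ²(F₂)` to the
corresponding bounded operator on the `ℓ²`-direct sum of `n` copies of `ℓ²(F₂)`; this realizes
the C*-norm on `Mₙ(B(ℓ²(F₂)))`. -/
def matOp {n : ℕ} (M : Matrix (Fin n) (Fin n) (H2 →L[ℂ] H2)) :
    PiLp 2 (fun _ : Fin n => H2) →L[ℂ] PiLp 2 (fun _ : Fin n => H2) :=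
  (((PiLp.continuousLinearEquiv 2 ℂ (fun _ : Fin n => H2)).symm :
      (∀ _ : Fin n, H2) →L[ℂ] PiLp 2 (fun _ : Fin n => H2)).comp
    (ContinuousLinearMap.pi (fun i => ∑ j, (M i j).comp (ContinuousLinearMap.proj j)))).comp
    ((PiLp.continuousLinearEquiv 2 ℂ (fun _ : Fin n => H2)) :
      PiLp 2 (fun _ : Fin n => H2) →L[ℂ] (∀ _ : Fin n, H2))

/-- The norm of an `n × n` matrix over `C*_r(F₂)`, i.e. the norm in `Mₙ(C*_r(F₂)) ⊆ Mₙ(B(ℓ²))`. -/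
def matNorm {n : ℕ} (u : Matrix (Fin n) (Fin n) CrF2) : ℝ :=
  ‖matOp (fun i j => (u i j : H2 →L[ℂ] H2))‖

/-- The partial-sum operators `S_m(x) = ∑_{n<m} a_n δ_{φ(n)}(x) λ_{φ(n)}` on `C*_r(F₂)`. -/
def frameOp (φ : ℕ → G2) (a : ℕ → ℝ) (m : ℕ) : CrF2 →L[ℂ] CrF2 :=
  ∑ n ∈ Finset.range m, ((a n : ℂ) • deltaCr (φ n)).smulRight (lamCr (φ n))

end

open Filter
open scoped ENNReal

section Rearrangement

/-- An injective sequence in a linear order, each of whose terms exceeds only finitely many others,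
can be rearranged to be strictly increasing. -/
lemma exists_perm_strictMono_comp {α : Type*} [LinearOrder α] {f : ℕ → α}
    (hf : Function.Injective f) (hfin : ∀ n, {m | f m < f n}.Finite) :
    ∃ σ : Equiv.Perm ℕ, StrictMono (f ∘ σ) := by
  classical
  let L : ℕ → Finset ℕ := fun n => (hfin n).toFinset
  have mem_L : ∀ m n, m ∈ L n ↔ f m < f n := fun m n => by simp [L]
  have key_lt : ∀ m n, f m < f n → (L m).card < (L n).card := fun m n h => by
    refine Finset.card_lt_card ((Finset.ssubset_iff_of_subset fun i hi => ?_).2 ⟨m, ?_, ?_⟩)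
    · exact (mem_L i n).2 (((mem_L i m).1 hi).trans h)
    · exact (mem_L m n).2 h
    · simp [mem_L]
  have inj : Function.Injective fun n => (L n).card := fun m n h => by
    by_contra hne
    rcases lt_or_gt_of_ne (hf.ne hne) with hlt | hlt
    · exact (key_lt m n hlt).ne h
    · exact (key_lt n m hlt).ne' h
  have surj : Function.Surjective fun n => (L n).card := fun N => by
    obtain ⟨_, ⟨n, rfl⟩, hn⟩ := (Set.infinite_range_of_injective inj).exists_gt N
    have hsurj := Finset.surjOn_of_injOn_of_card_le (s := L n) (t := Finset.range (L n).card)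
      (fun m => (L m).card)
      (fun m hm => by simpa using key_lt m n ((mem_L m n).1 hm)) inj.injOn (by simp)
    obtain ⟨m, -, hm⟩ := hsurj (by simpa using hn : N ∈ (Finset.range (L n).card : Set ℕ))
    exact ⟨m, hm⟩
  let e : Equiv.Perm ℕ := Equiv.ofBijective _ ⟨inj, surj⟩
  refine ⟨e.symm, fun i j hij => ?_⟩
  by_contra h
  rcases (not_lt.1 h).lt_or_eq with hlt | heq
  · have := key_lt _ _ hlt
    have hi : (L (e.symm i)).card = i := e.apply_symm_apply i
    have hj : (L (e.symm j)).card = j := e.apply_symm_apply j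
    omega
  · exact hij.ne' (e.symm.injective (hf heq))

/-- A finite-to-one sequence of natural numbers can be rearranged to be monotone. -/
lemma exists_perm_monotone_comp {r : ℕ → ℕ} (hr : ∀ c, (r ⁻¹' {c}).Finite) :
    ∃ σ : Equiv.Perm ℕ, Monotone (r ∘ σ) := by
  obtain ⟨σ, hσ⟩ := exists_perm_strictMono_comp (f := fun n => toLex (r n, n))
    (fun m n h => congrArg (fun p => (ofLex p).2) h) (fun n => by
      refine ((Set.finite_Iic (r n)).preimage' fun c _ => hr c).subset fun m hm => ?_
      rcases Prod.Lex.toLex_lt_toLex.1 hm with h | h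
      · exact h.le
      · exact h.1.le)
  refine ⟨σ, fun i j hij => ?_⟩
  rcases Prod.Lex.toLex_le_toLex.1 (hσ.monotone hij) with h | h
  · exact h.le
  · exact h.1.le

/-- A series all of whose rearrangements have Cauchy partial sums is summable. -/
lemma summable_of_forall_perm_cauchySeq {E : Type*} [NormedAddCommGroup E] [CompleteSpace E]
    {f : ℕ → E}
    (h : ∀ σ : Equiv.Perm ℕ, CauchySeq fun N => ∑ n ∈ Finset.range N, f (σ n)) :
    Summable f := by
  classical
  by_contra hf
  rw [summable_iff_vanishing_norm] at hf
  push Not at hf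
  obtain ⟨ε, hε, hf⟩ := hf
  obtain ⟨A, hA, hdisj⟩ := exists_seq_of_forall_finset_exists
    (fun t : Finset ℕ => ε ≤ ‖∑ n ∈ t, f n‖) Disjoint (fun S _ => by
      obtain ⟨t, ht, hle⟩ := hf (S.biUnion id)
      exact ⟨t, hle, fun s hs => (ht.mono_right (Finset.subset_biUnion_of_mem id hs)).symm⟩)
  have huniq : ∀ n j k, n ∈ A j → n ∈ A k → j = k := fun n j k hj hk => by
    rcases lt_trichotomy j k with hlt | heq | hlt
    · exact absurd hk (Finset.disjoint_left.1 (hdisj j k hlt) hj)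
    · exact heq
    · exact absurd hj (Finset.disjoint_left.1 (hdisj k j hlt) hk)
  let r : ℕ → ℕ := fun n => if hn : ∃ k, n ∈ A k then 2 * hn.choose else 2 * n + 1
  have r_even : ∀ n k, r n = 2 * k ↔ n ∈ A k := fun n k => by
    by_cases hn : ∃ k, n ∈ A k
    · simp only [r, dif_pos hn]
      refine ⟨fun hk => ?_, fun hk => ?_⟩
      · have := hn.choose_spec
        rwa [show hn.choose = k by omega] at this
      · rw [huniq n _ k hn.choose_spec hk]
    · simp only [r, dif_neg hn]
      exact ⟨fun hk => by omega, fun hk => absurd ⟨k, hk⟩ hn⟩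
  have r_odd : ∀ n k, r n = 2 * k + 1 → n = k := fun n k => by
    by_cases hn : ∃ k, n ∈ A k
    · simp only [r, dif_pos hn]
      omega
    · simp only [r, dif_neg hn]
      omega
  have hr : ∀ c, (r ⁻¹' {c}).Finite := fun c => by
    rcases Nat.even_or_odd' c with ⟨k, rfl | rfl⟩
    · exact (A k).finite_toSet.subset fun n hn => (r_even n k).1 hn
    · exact (Set.finite_singleton k).subset fun n hn => r_odd n k hn
  obtain ⟨σ, hσ⟩ := exists_perm_monotone_comp hr
  have hcut : ∀ c, ∃ m, ∀ i, i < m ↔ r (σ i) < c := fun c => by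
    have hex : ∃ i, c ≤ r (σ i) := by
      by_contra hne
      push Not at hne
      refine Set.infinite_univ (((Set.finite_Iio c).preimage' fun d _ => hr d).subset ?_)
      intro n _
      simpa using hne (σ.symm n)
    refine ⟨Nat.find hex, fun i => ⟨fun hi => not_le.1 (Nat.find_min hex hi), fun hi => ?_⟩⟩
    by_contra hle
    exact absurd ((Nat.find_spec hex).trans (hσ (not_lt.1 hle))) (not_le.2 hi)
  choose m hm using hcut
  have hmono : Monotone m := fun c d hcd => by
    by_contra hlt
    have h1 := (hm c (m d)).1 (not_le.1 hlt)
    exact lt_irrefl _ ((hm d (m d)).2 (h1.trans_le hcd))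
  have hlarge : ∀ N, ∃ k, N ≤ m (2 * k) := fun N => by
    refine ⟨r (σ N) + 1, ((hm _ N).2 ?_).le⟩
    omega
  obtain ⟨N, hN⟩ := Metric.cauchySeq_iff.1 (h σ) ε hε
  obtain ⟨k, hk⟩ := hlarge N
  have hle : m (2 * k) ≤ m (2 * k + 1) := hmono (Nat.le_succ _)
  have hlt := hN _ (hk.trans hle) _ hk
  rw [dist_eq_norm, ← Finset.sum_Ico_eq_sub _ hle] at hlt
  have himage : (Finset.Ico (m (2 * k)) (m (2 * k + 1))).map σ.toEmbedding = A k := by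
    ext n
    obtain ⟨i, rfl⟩ := σ.surjective n
    rw [← r_even, Finset.mem_map_equiv, Equiv.symm_apply_apply, Finset.mem_Ico, hm, ← not_lt, hm]
    omega
  have hsum := Finset.sum_map (Finset.Ico (m (2 * k)) (m (2 * k + 1))) σ.toEmbedding f
  rw [himage] at hsum
  exact absurd (hA k) (not_le.2 (by rw [hsum]; exact hlt))

lemma Summable.exists_norm_sum_le {ι E : Type*} [NormedAddCommGroup E] [CompleteSpace E]
    {f : ι → E} (hf : Summable f) : ∃ C, ∀ s : Finset ι, ‖∑ i ∈ s, f i‖ ≤ C := by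
  classical
  obtain ⟨t, ht⟩ := summable_iff_vanishing_norm.1 hf 1 one_pos
  refine ⟨∑ i ∈ t, ‖f i‖ + 1, fun s => ?_⟩
  rw [← Finset.sum_inter_add_sum_sdiff s t]
  refine (norm_add_le _ _).trans (add_le_add ?_ (ht _ Finset.sdiff_disjoint).le)
  exact (norm_sum_le _ _).trans (Finset.sum_le_sum_of_subset_of_nonneg
    Finset.inter_subset_right fun _ _ _ => norm_nonneg _)

/-- If the coordinate expansion of every vector, with each coordinate split into countably many
parts, converges in every order, then the coordinate projections onto finite sets are uniformly
bounded. -/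
lemma exists_norm_sum_smul_le_of_forall_perm {ι E : Type*} [NormedAddCommGroup E]
    [NormedSpace ℂ E] [CompleteSpace E] (d : ι → E →L[ℂ] ℂ) (v : ι → E) (φ : ℕ → ι) (a : ℕ → ℝ)
    (ha : ∀ s, ∑' n : (φ ⁻¹' {s} : Set ℕ), a n = 1)
    (h : ∀ (x : E) (σ : Equiv.Perm ℕ),
      CauchySeq fun N => ∑ n ∈ Finset.range N, ((a (σ n) : ℂ) * d (φ (σ n)) x) • v (φ (σ n))) :
    ∃ C, ∀ (S : Finset ι) (x : E), ‖∑ s ∈ S, d s x • v s‖ ≤ C * ‖x‖ := by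
  classical
  have hbdd : ∀ x : E, ∃ C, ∀ F : Finset ℕ,
      ‖(∑ n ∈ F, ((a n : ℂ) • d (φ n)).smulRight (v (φ n))) x‖ ≤ C := fun x => by
    obtain ⟨C, hC⟩ := (summable_of_forall_perm_cauchySeq
      (f := fun n => ((a n : ℂ) * d (φ n) x) • v (φ n))
      fun σ => h x σ).exists_norm_sum_le
    exact ⟨C, fun F => by simpa using hC F⟩
  obtain ⟨C, hC⟩ := banach_steinhaus hbdd
  have hmass : ∀ s, HasSum (fun n => if φ n = s then (a n : ℂ) else 0) 1 := fun s => by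
    have hs : Summable fun n : (φ ⁻¹' {s} : Set ℕ) => a n := by
      by_contra hns
      simpa [tsum_eq_zero_of_not_summable hns] using ha s
    have h1 := hs.hasSum
    rw [ha s] at h1
    have h2 := (hasSum_subtype_iff_indicator (f := a)).1 h1
    convert Complex.hasSum_ofReal.2 h2 using 1
    · funext n
      by_cases hn : φ n = s <;> simp [Set.indicator, hn]
    · simp
  refine ⟨C, fun S x => ?_⟩
  have hsum : HasSum (fun n => ∑ s ∈ S, (if φ n = s then (a n : ℂ) else 0) • d s x • v s)
      (∑ s ∈ S, d s x • v s) := by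
    refine hasSum_sum fun s _ => ?_
    simpa using (hmass s).smul_const (d s x • v s)
  refine le_of_tendsto hsum.norm (Eventually.of_forall fun F => ?_)
  have hF : ∑ n ∈ F, ∑ s ∈ S, (if φ n = s then (a n : ℂ) else 0) • d s x • v s =
      (∑ n ∈ F with φ n ∈ S, ((a n : ℂ) • d (φ n)).smulRight (v (φ n))) x := by
    rw [Finset.sum_filter, _root_.sum_apply]
    refine Finset.sum_congr rfl fun n _ => ?_
    simp only [ite_smul, zero_smul, Finset.sum_ite_eq]
    split_ifs <;> simp [mul_smul]
  rw [hF]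
  exact ContinuousLinearMap.le_of_opNorm_le _ (hC _) x

/-- A version of `exists_norm_sum_smul_le_of_forall_perm` for a closed subspace. -/
lemma exists_forall_mem_norm_sum_smul_le_of_forall_perm {ι E : Type*} [NormedAddCommGroup E]
    [NormedSpace ℂ E] [CompleteSpace E] {V : Submodule ℂ E} (hV : IsClosed (V : Set E))
    (d : ι → E →L[ℂ] ℂ) {v : ι → E} (hv : ∀ s, v s ∈ V) (φ : ℕ → ι) (a : ℕ → ℝ)
    (ha : ∀ s, ∑' n : (φ ⁻¹' {s} : Set ℕ), a n = 1)
    (h : ∀ x ∈ V, ∀ σ : Equiv.Perm ℕ,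
      CauchySeq fun N => ∑ n ∈ Finset.range N, ((a (σ n) : ℂ) * d (φ (σ n)) x) • v (φ (σ n))) :
    ∃ C, ∀ (S : Finset ι), ∀ x ∈ V, ‖∑ s ∈ S, d s x • v s‖ ≤ C * ‖x‖ := by
  have : CompleteSpace V := hV.completeSpace_coe
  obtain ⟨C, hC⟩ := exists_norm_sum_smul_le_of_forall_perm (fun s => (d s).comp V.subtypeL)
    (fun s => (⟨v s, hv s⟩ : V)) φ a ha fun x σ => by
      refine isUniformEmbedding_subtype_val.isUniformInducing.cauchy_map_iff.1 ?_
      simpa [CauchySeq, Filter.map_map, Function.comp_def] using h x x.2 σ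
  exact ⟨C, fun S x hx => by simpa using hC S ⟨x, hx⟩⟩

end Rearrangement

/-- Rudin–Shapiro polynomials in an isometry: there are `±1`-valued coefficients for which the
polynomial with `2 ^ k` terms has norm at most `√(2 ^ (k + 1))`. -/
lemma exists_rudinShapiro (k : ℕ) : ∃ p q : ℕ → ℂ,
    (∀ i, p i = 1 ∨ p i = -1) ∧ (∀ i, q i = 1 ∨ q i = -1) ∧
    ∀ {E : Type*} [NormedAddCommGroup E] [InnerProductSpace ℂ E] (U : E →L[ℂ] E)
      (_ : ∀ ξ, ‖U ξ‖ = ‖ξ‖) (ξ : E),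
      ‖(∑ i ∈ Finset.range (2 ^ k), p i • U ^ i) ξ‖ ^ 2 +
        ‖(∑ i ∈ Finset.range (2 ^ k), q i • U ^ i) ξ‖ ^ 2 = 2 ^ (k + 1) * ‖ξ‖ ^ 2 := by
  induction k with
  | zero =>
    refine ⟨fun _ => 1, fun _ => 1, fun _ => Or.inl rfl, fun _ => Or.inl rfl, ?_⟩
    intro E _ _ U _ ξ
    simp
    ring
  | succ k ih =>
    obtain ⟨p, q, hp, hq, h⟩ := ih
    refine ⟨fun i => if i < 2 ^ k then p i else q (i - 2 ^ k),
      fun i => if i < 2 ^ k then p i else -q (i - 2 ^ k), fun i => ?_, fun i => ?_, ?_⟩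
    · dsimp only
      split_ifs
      exacts [hp i, hq _]
    · dsimp only
      split_ifs
      · exact hp i
      · rcases hq (i - 2 ^ k) with h | h <;> simp [h]
    intro E _ _ U hU ξ
    have hUpow : ∀ (n : ℕ) (η : E), ‖(U ^ n) η‖ = ‖η‖ := fun n => by
      induction n with
      | zero => simp
      | succ n ihn => intro η; rw [pow_succ, mul_apply_eq_comp, ihn, hU]
    have hsplit : ∀ c d : ℕ → ℂ,
        ∑ i ∈ Finset.range (2 ^ (k + 1)), (if i < 2 ^ k then c i else d (i - 2 ^ k)) • U ^ i =
          ∑ i ∈ Finset.range (2 ^ k), c i • U ^ i +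
            U ^ 2 ^ k * ∑ i ∈ Finset.range (2 ^ k), d i • U ^ i := fun c d => by
      rw [pow_succ, mul_two, Finset.sum_range_add, Finset.mul_sum]
      congr 1
      · exact Finset.sum_congr rfl fun i hi => by rw [if_pos (Finset.mem_range.1 hi)]
      · exact Finset.sum_congr rfl fun i _ => by
          rw [if_neg (by omega), Nat.add_sub_cancel_left, pow_add, mul_smul_comm]
    rw [hsplit p q, hsplit p fun i => -q i]
    simp only [neg_smul, Finset.sum_neg_distrib, mul_neg, ← sub_eq_add_neg]
    rw [add_apply, sub_apply,
      parallelogram_law_with_norm ℂ, mul_apply_eq_comp, hUpow, h U hU ξ]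
    ring

section RegularRepresentation

lemma lam_apply (s : G2) (ξ : H2) (t : G2) : lam s ξ t = ξ (s⁻¹ * t) := rfl

lemma norm_lam_apply (s : G2) (ξ : H2) : ‖lam s ξ‖ = ‖ξ‖ := by
  have h2 : (0:ℝ) < (2 : ℝ≥0∞).toReal := by norm_num
  rw [lp.norm_eq_tsum_rpow h2, lp.norm_eq_tsum_rpow h2]
  congr 1
  exact (Equiv.mulLeft (s⁻¹ : G2)).tsum_eq (f := fun t : G2 => ‖ξ t‖ ^ (2 : ℝ≥0∞).toReal)

lemma lam_one : lam 1 = 1 := by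
  ext ξ t
  simp [lam_apply]

lemma lam_mul (s t : G2) : lam (s * t) = lam s * lam t := by
  ext ξ u
  simp [lam_apply, mul_assoc]

lemma lam_pow (s : G2) (n : ℕ) : lam (s ^ n) = lam s ^ n := by
  induction n with
  | zero => simp [lam_one]
  | succ n ih => rw [pow_succ, lam_mul, ih, pow_succ]

lemma deltaVec_apply (s t : G2) : deltaVec s t = if t = s then 1 else 0 := by
  simp [deltaVec, Pi.single_apply]

lemma lam_deltaVec (s t : G2) : lam s (deltaVec t) = deltaVec (s * t) := by
  ext u
  rw [lam_apply, deltaVec_apply, deltaVec_apply]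
  simp [inv_mul_eq_iff_eq_mul]

lemma inner_deltaVec (s t : G2) :
    inner ℂ (deltaVec s) (deltaVec t) = if s = t then 1 else 0 := by
  rw [deltaVec, lp.inner_single_left, deltaVec_apply]
  simp

lemma deltaFn_lam (s t : G2) : deltaFn s (lam t) = if s = t then 1 else 0 := by
  change inner ℂ (deltaVec s) (lam t (deltaVec 1)) = _
  rw [lam_deltaVec, mul_one, inner_deltaVec]

lemma inner_deltaVec_sum_pow {g : G2} (hg : Function.Injective fun n : ℕ => g ^ n) (m i : ℕ) :
    inner ℂ (∑ j ∈ Finset.range m, deltaVec (g ^ j)) (deltaVec (g ^ i)) =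
      if i < m then 1 else 0 := by
  simp [inner_deltaVec, hg.eq_iff]

lemma norm_sum_deltaVec_pow {g : G2} (hg : Function.Injective fun n : ℕ => g ^ n) (m : ℕ) :
    ‖∑ j ∈ Finset.range m, deltaVec (g ^ j)‖ = √m := by
  rw [norm_eq_sqrt_re_inner (𝕜 := ℂ), inner_sum,
    Finset.sum_congr rfl fun i hi => (inner_deltaVec_sum_pow hg m i).trans
      (if_pos (Finset.mem_range.1 hi))]
  simp

lemma natCast_le_norm_sum_lam_pow {g : G2} (hg : Function.Injective fun n : ℕ => g ^ n) (n : ℕ) :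
    (n : ℝ) ≤ √2 * ‖∑ i ∈ Finset.range n, lam (g ^ i)‖ := by
  rcases n.eq_zero_or_pos with rfl | hn
  · simp
  set D := ∑ i ∈ Finset.range n, lam (g ^ i) with hD
  have hinner : inner ℂ (∑ j ∈ Finset.range (2 * n), deltaVec (g ^ j))
      (D (∑ j ∈ Finset.range n, deltaVec (g ^ j))) = (n : ℂ) * n := by
    have hterm : ∀ i ∈ Finset.range n, ∀ j ∈ Finset.range n,
        inner ℂ (∑ j ∈ Finset.range (2 * n), deltaVec (g ^ j)) (deltaVec (g ^ i * g ^ j)) =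
          (1 : ℂ) := fun i hi j hj => by
      rw [Finset.mem_range] at hi hj
      rw [← pow_add, inner_deltaVec_sum_pow hg, if_pos (by omega)]
    rw [hD, sum_apply, inner_sum]
    simp_rw [map_sum, lam_deltaVec, inner_sum]
    rw [Finset.sum_congr rfl fun i hi => Finset.sum_congr rfl (hterm i hi)]
    simp
  have hle := (norm_inner_le_norm (𝕜 := ℂ) (∑ j ∈ Finset.range (2 * n), deltaVec (g ^ j))
    (D (∑ j ∈ Finset.range n, deltaVec (g ^ j)))).trans
      (mul_le_mul_of_nonneg_left (D.le_opNorm _) (norm_nonneg _))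
  rw [hinner, norm_sum_deltaVec_pow hg, norm_sum_deltaVec_pow hg, norm_mul, Complex.norm_natCast,
    Nat.cast_mul, Real.sqrt_mul (by positivity)] at hle
  have hn' : (0 : ℝ) < n := by exact_mod_cast hn
  have hsq : √(n : ℝ) * √n = n := Real.mul_self_sqrt hn'.le
  refine le_of_mul_le_mul_right ?_ hn'
  calc (n : ℝ) * n ≤ √(2 : ℕ) * √n * (‖D‖ * √n) := hle
    _ = √2 * ‖D‖ * (√n * √n) := by push_cast; ring
    _ = √2 * ‖D‖ * n := by rw [hsq]

/-- The coordinate projections of the system `(λ_s)` onto finite sets are not uniformly bounded. -/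
lemma not_forall_norm_sum_deltaFn_smul_le (C : ℝ) :
    ¬ ∀ (S : Finset G2), ∀ x ∈ CrF2, ‖∑ s ∈ S, deltaFn s x • lam s‖ ≤ C * ‖x‖ := by
  classical
  intro hC
  let g : G2 := FreeGroup.of 0
  have hg : Function.Injective fun n : ℕ => g ^ n := fun m n h => by
    simpa [g] using congrArg FreeGroup.norm h
  have hC0 : 0 ≤ C := by
    have h1 := hC ∅ (lam 1) (lam_mem_CrF2 1)
    have hne : lam 1 ≠ 0 := fun h0 => by simpa [h0] using deltaFn_lam 1 1
    rw [Finset.sum_empty, norm_zero] at h1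
    exact nonneg_of_mul_nonneg_left h1 (norm_pos_iff.2 hne)
  obtain ⟨k, hk⟩ := pow_unbounded_of_one_lt (4 * (2 * C + 1) ^ 2) (one_lt_two (α := ℝ))
  obtain ⟨p, q, hp, -, hpq⟩ := exists_rudinShapiro k
  set n : ℕ := 2 ^ k with hn
  let x : H2 →L[ℂ] H2 := ∑ i ∈ Finset.range n, p i • lam (g ^ i)
  have hxmem : x ∈ CrF2 :=
    Submodule.sum_mem _ fun i _ => Submodule.smul_mem _ _ (lam_mem_CrF2 _)
  have hx : ‖x‖ ≤ √(2 * n) := by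
    refine ContinuousLinearMap.opNorm_le_bound _ (Real.sqrt_nonneg _) fun ξ => ?_
    refine le_of_sq_le_sq ?_ (by positivity)
    rw [mul_pow, Real.sq_sqrt (by positivity)]
    have h := hpq (lam g) (norm_lam_apply g) ξ
    have hcast : (n : ℝ) = 2 ^ k := by simp [hn]
    rw [hcast, ← pow_succ', ← h]
    simp only [x, lam_pow]
    exact le_add_of_nonneg_right (sq_nonneg _)
  have hcoef : ∀ i ∈ Finset.range n, deltaFn (g ^ i) x = p i := fun i hi => by
    simp [x, deltaFn_lam, hg.eq_iff, Finset.mem_range.1 hi]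
  let I := (Finset.range n).filter fun i => p i = 1
  have hproj : ∑ s ∈ I.image fun i => g ^ i, deltaFn s x • lam s = ∑ i ∈ I, lam (g ^ i) := by
    rw [Finset.sum_image hg.injOn]
    refine Finset.sum_congr rfl fun i hi => ?_
    obtain ⟨hi, hpi⟩ := Finset.mem_filter.1 hi
    rw [hcoef i hi, hpi, one_smul]
  have hsum : ∑ i ∈ Finset.range n, lam (g ^ i) = (2 : ℂ) • ∑ i ∈ I, lam (g ^ i) - x := by
    simp only [I, x, Finset.sum_filter, Finset.smul_sum, ← Finset.sum_sub_distrib]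
    refine Finset.sum_congr rfl fun i _ => ?_
    rcases hp i with h | h
    · simp [h, two_smul]
    · rw [h, if_neg (by norm_num), smul_zero, zero_sub, neg_smul, one_smul, neg_neg]
  have hD : ‖∑ i ∈ Finset.range n, lam (g ^ i)‖ ≤ (2 * C + 1) * √(2 * n) := by
    rw [hsum, ← hproj]
    calc _ ≤ 2 * (C * ‖x‖) + ‖x‖ := by
          refine (norm_sub_le _ _).trans ?_
          rw [norm_smul, Complex.norm_two]
          gcongr
          exact hC _ x hxmem
      _ = (2 * C + 1) * ‖x‖ := by ring
      _ ≤ _ := by gcongr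
  have hbound : (n : ℝ) ≤ √2 * ((2 * C + 1) * √(2 * n)) :=
    (natCast_le_norm_sum_lam_pow hg n).trans (by gcongr)
  have hn0 : (0 : ℝ) < n := by simp [hn]
  have hsq : (n : ℝ) ^ 2 ≤ 4 * (2 * C + 1) ^ 2 * n := by
    calc (n : ℝ) ^ 2 ≤ (√2 * ((2 * C + 1) * √(2 * n))) ^ 2 := by gcongr
      _ = 4 * (2 * C + 1) ^ 2 * n := by
        rw [mul_pow, mul_pow, Real.sq_sqrt (by positivity), Real.sq_sqrt (by positivity)]
        ring
  have hk' : 4 * (2 * C + 1) ^ 2 < (n : ℝ) := by simpa [hn] using hk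
  nlinarith

end RegularRepresentation

/-- No frame for `C*_r(F₂)` of the form `(λ_{φ(n)}, a_n δ_{φ(n)})`, with `φ : ℕ → F₂`
surjective, `a_n > 0` and `∑_{n ∈ φ⁻¹(s)} a_n = 1` for every `s`, is unconditional: it is
not the case that for every `x ∈ C*_r(F₂)` and every permutation `σ` of `ℕ` the series
`∑_n a_{σ(n)} δ_{φ(σ(n))}(x) λ_{φ(σ(n))}` converges in norm to `x`. -/
theorem not_unconditional_frame_CrF2
    (φ : ℕ → G2) (hφ : Function.Surjective φ)
    (a : ℕ → ℝ) (ha : ∀ n, 0 < a n)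
    (hconvex : ∀ s : G2, ∑' n : (φ ⁻¹' {s} : Set ℕ), a (n : ℕ) = 1) :
    ¬ (∀ (x : CrF2) (σ : Equiv.Perm ℕ),
        Filter.Tendsto
          (fun N => ∑ n ∈ Finset.range N,
            ((a (σ n) : ℂ) * deltaCr (φ (σ n)) x) • lamCr (φ (σ n)))
          Filter.atTop (nhds x)) := by
  intro h
  have hclosed : IsClosed (CrF2 : Set (H2 →L[ℂ] H2)) := Submodule.isClosed_topologicalClosure _
  obtain ⟨C, hC⟩ := exists_forall_mem_norm_sum_smul_le_of_forall_perm hclosed deltaFn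
    lam_mem_CrF2 φ a hconvex fun x hx σ => by
      have hlim := (continuous_subtype_val.tendsto _).comp (h ⟨x, hx⟩ σ)
      refine Filter.Tendsto.cauchySeq (x := x) (hlim.congr fun N => ?_)
      rw [Function.comp_apply, AddSubmonoidClass.coe_finsetSum]
      rfl
  exact not_forall_norm_sum_deltaFn_smul_le C hC
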